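/- For every y ∈ {0,1}^n and every s_1, …, s_ℓ ∈ {0,1}^n, the single y-momentum hopping operator satisfies G̃_y (â_{s_1}† ⋯ â_{s_ℓ}† |vac⟩) = (ℓ^{−1/2} ∑_{i=1}^ℓ (−1)^{y·s_i}) · (â_{s_1}† ⋯ â_{s_ℓ}† |vac⟩). Consequently G̃_y² is diagonal in the position Fock basis of the ℓ-boson space, with G̃_y² (â_{s_1}† ⋯ â_{s_ℓ}† |vac⟩) = γ_y^{(S)} · (â_{s_1}† ⋯ â_{s_ℓ}† |vac⟩), where S = {s_1,…,s_ℓ} and γ_y^{(S)} = ((1/√ℓ) ∑_{i=1}^ℓ (−1)^{y·s_i})². -/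

import Mathlib

open scoped BigOperators

/-- The group `{0,1}^n` with bitwise XOR as addition. -/
abbrev BV (n : ℕ) : Type := Fin n → ZMod 2

/-- Occupation tuples: functions assigning a number of bosons to each mode. -/
abbrev OccT (n : ℕ) : Type := BV n → ℕ

/-- The full bosonic Fock space: formal (finitely supported) complex combinations of
position Fock basis states `|u⟩`, one for each occupation tuple `u`. -/
abbrev FockV (n : ℕ) : Type := OccT n →₀ ℂ

/-- Operators on the Fock space. -/
abbrev FockOp (n : ℕ) : Type := Module.End ℂ (FockV n)

/-- The annihilation operator `â_x`: on basis states, `â_x|u⟩ = √(u_x)|u − 1_x⟩`. -/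
noncomputable def ann (n : ℕ) (x : BV n) : FockOp n :=
  Finsupp.lift (FockV n) ℂ (OccT n) fun u =>
    ((Real.sqrt (u x) : ℝ) : ℂ) • Finsupp.single (Function.update u x (u x - 1)) 1

/-- The creation operator `â_x†`: on basis states, `â_x†|u⟩ = √(u_x + 1)|u + 1_x⟩`. -/
noncomputable def cre (n : ℕ) (x : BV n) : FockOp n :=
  Finsupp.lift (FockV n) ℂ (OccT n) fun u =>
    ((Real.sqrt (u x + 1) : ℝ) : ℂ) • Finsupp.single (Function.update u x (u x + 1)) 1

/-- The number operator `n̂_z = â_z† â_z`. -/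
noncomputable def numOp (n : ℕ) (z : BV n) : FockOp n := cre n z * ann n z

/-- The sign `(−1)^{x·y}` (as a real number), `x·y` the mod-2 inner product. -/
noncomputable def chiR {n : ℕ} (x y : BV n) : ℝ :=
  if (∑ j, x j * y j : ZMod 2) = 0 then 1 else -1

/-- The momentum annihilation operator `ã_y = 2^{−n/2} ∑_x (−1)^{x·y} â_x`. -/
noncomputable def mann (n : ℕ) (y : BV n) : FockOp n :=
  (((Real.sqrt ((2 : ℝ) ^ n))⁻¹ : ℝ) : ℂ) • ∑ x : BV n, ((chiR x y : ℝ) : ℂ) • ann n x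

/-- The momentum creation operator `ã_y† = 2^{−n/2} ∑_x (−1)^{x·y} â_x†`. -/
noncomputable def mcre (n : ℕ) (y : BV n) : FockOp n :=
  (((Real.sqrt ((2 : ℝ) ^ n))⁻¹ : ℝ) : ℂ) • ∑ x : BV n, ((chiR x y : ℝ) : ℂ) • cre n x

/-- The vacuum state `|vac⟩`. -/
noncomputable def vac (n : ℕ) : FockV n := Finsupp.single 0 1

/-- The momentum Fock state `|ũ⟩ = (∏_x (ã_x†)^{u_x}/√(u_x!)) |vac⟩`. -/
noncomputable def momFock (n : ℕ) (u : OccT n) : FockV n :=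
  (((∏ x : BV n, Real.sqrt ((u x).factorial) : ℝ)⁻¹ : ℝ) : ℂ) •
    ((Finset.univ.toList (α := BV n)).map fun x => (mcre n x) ^ (u x)).prod (vac n)

/-- The number of modes `x ≠ 0` with an odd number of bosons. -/
def oddCount (n : ℕ) (u : OccT n) : ℕ :=
  (Finset.univ.filter fun x : BV n => x ≠ 0 ∧ Odd (u x)).card

/-- The orthogonal projection (in the `ℓ`-boson space) onto the span of the momentum Fock
states `|ũ⟩` over occupation tuples `u` with `∑_x u_x = ℓ` satisfying `P`.  Since the
momentum Fock states `{|ũ⟩ : ∑ u = ℓ}` form an orthonormal basis of the `ℓ`-boson space,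
this projection equals `∑_u |ũ⟩⟨ũ|`, which on a position basis state `|w⟩` gives
`∑_u conj(⟨w|ũ⟩) |ũ⟩`. -/
noncomputable def projOn (n ℓ : ℕ) (P : OccT n → Prop) [DecidablePred P] : FockOp n :=
  Finsupp.lift (FockV n) ℂ (OccT n) fun w =>
    ∑ v : BV n → Fin (ℓ + 1),
      if (∑ x, ((v x : ℕ))) = ℓ ∧ P (fun x => (v x : ℕ))
      then (starRingEnd ℂ) (momFock n (fun x => (v x : ℕ)) w) • momFock n (fun x => (v x : ℕ))
      else 0

/-- `Con_r` (`conProj`): the projection onto the span of momentum Fock states of `r`-condensate tuples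
(`ℓ`-boson tuples with at least `ℓ − r` bosons in the `0`-momentum mode). -/
noncomputable def conProj (n ℓ r : ℕ) : FockOp n :=
  projOn n ℓ fun u => ℓ - r ≤ u 0

/-- `QEC_{(r,o)}`: the projection onto the span of momentum Fock states of
`(r,o)`-quasi-even condensate tuples. -/
noncomputable def QEC (n ℓ r o : ℕ) : FockOp n :=
  projOn n ℓ fun u => ℓ - r ≤ u 0 ∧ oddCount n u ≤ o

/-- `QE_{=o}`: the projection onto momentum Fock states with exactly `o` odd
nonzero-momentum modes. -/
noncomputable def QEeq (n ℓ o : ℕ) : FockOp n :=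
  projOn n ℓ fun u => oddCount n u = o

/-- `QEC_{(R,=o)}`: the projection onto momentum Fock states of `R`-condensate tuples with
exactly `o` odd nonzero-momentum modes. -/
noncomputable def QECeq (n ℓ R o : ℕ) : FockOp n :=
  projOn n ℓ fun u => (ℓ - R ≤ u 0 ∧ oddCount n u = o)

/-- The squared Hilbert norm `‖ψ‖² = ∑_u |ψ_u|²`. -/
noncomputable def nsq (n : ℕ) (ψ : FockV n) : ℝ := ψ.sum fun _ c => Complex.normSq c

/-- The inner product `⟨φ, ψ⟩ = ∑_u conj(φ_u) ψ_u` (antilinear in the first argument). -/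
noncomputable def finner (n : ℕ) (φ ψ : FockV n) : ℂ :=
  φ.sum fun u c => (starRingEnd ℂ) c * ψ u

/-- The single `y`-momentum hopping operator `G̃_y = ℓ^{−1/2} ∑_x ã_{x⊕y}† ã_x`. -/
noncomputable def sHop (n ℓ : ℕ) (y : BV n) : FockOp n :=
  (((Real.sqrt (ℓ : ℝ))⁻¹ : ℝ) : ℂ) • ∑ x : BV n, mcre n (x + y) * mann n x

/-- The double `y`-momentum hopping operator
`H̃_y = ℓ^{−1} ∑_{x,x'} ã_{x⊕y}† ã_{x'⊕y}† ã_x ã_{x'}`. -/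
noncomputable def dHop (n ℓ : ℕ) (y : BV n) : FockOp n :=
  ((ℓ : ℂ))⁻¹ • ∑ x : BV n, ∑ x' : BV n,
    mcre n (x + y) * mcre n (x' + y) * mann n x * mann n x'

/-- The state `â_{s_1}† ⋯ â_{s_ℓ}† |vac⟩`. -/
noncomputable def creChain (n ℓ : ℕ) (s : Fin ℓ → BV n) : FockV n :=
  ((List.ofFn fun i => cre n (s i)).prod) (vac n)

lemma chiR_add_right' {n : ℕ} (c x y : BV n) : chiR c (x + y) = chiR c x * chiR c y := by
  unfold chiR
  simp only [Pi.add_apply, mul_add, Finset.sum_add_distrib]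
  generalize (∑ j, c j * x j : ZMod 2) = a
  generalize (∑ j, c j * y j : ZMod 2) = b
  have h : ∀ a b : ZMod 2, (a + b = 0 ↔ a = b) := by decide
  have h2 : ∀ a : ZMod 2, a = 0 ∨ a = 1 := by decide
  rcases h2 a with rfl | rfl <;> rcases h2 b with rfl | rfl <;> simp [h]

lemma chiR_comm' {n : ℕ} (x y : BV n) : chiR x y = chiR y x := by
  unfold chiR
  simp only [mul_comm]

lemma chiR_sum_zero' {n : ℕ} (c : BV n) (hc : c ≠ 0) : ∑ x : BV n, chiR c x = 0 := by
  obtain ⟨j, hj⟩ := Function.ne_iff.mp hc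
  have h1 : chiR c (Pi.single j 1) = -1 := by
    unfold chiR
    simp only [Pi.single_apply, mul_ite, mul_one, mul_zero, Finset.sum_ite_eq', Finset.mem_univ, if_true]
    exact if_neg hj
  have h2 : ∑ x : BV n, chiR c (x + Pi.single j 1) = ∑ x : BV n, chiR c x :=
    Equiv.sum_comp (Equiv.addRight (Pi.single j 1 : BV n)) (fun x => chiR c x)
  simp only [chiR_add_right', h1, ← Finset.sum_mul] at h2
  linarith

lemma chiR_orth' {n : ℕ} (a b y : BV n) :
    ∑ x : BV n, chiR a (x + y) * chiR b x = if a = b then 2 ^ n * chiR a y else 0 := by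
  have h : ∀ x : BV n, chiR a (x + y) * chiR b x = chiR (a + b) x * chiR a y := by
    intro x
    rw [chiR_add_right', chiR_comm' (a + b), chiR_add_right', chiR_comm' x a, chiR_comm' x b]
    ring
  simp only [h, ← Finset.sum_mul]
  split_ifs with hab
  · subst hab
    have : a + a = 0 := by
      funext j
      exact CharTwo.add_self_eq_zero (a j)
    rw [this]
    congr 1
    simp [chiR, BV]
  · rw [chiR_sum_zero', zero_mul]
    intro h0
    apply hab
    funext j
    exact CharTwo.add_eq_zero.mp (congrFun h0 j)

lemma cre_single' (n : ℕ) (x : BV n) (u : OccT n) : cre n x (Finsupp.single u 1) =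
    ((Real.sqrt (u x + 1) : ℝ) : ℂ) • Finsupp.single (Function.update u x (u x + 1)) 1 := by
  rw [cre, Finsupp.lift_apply, Finsupp.sum_single_index]
  · exact one_smul ℂ _
  · exact zero_smul ℂ _

lemma ann_single' (n : ℕ) (x : BV n) (u : OccT n) : ann n x (Finsupp.single u 1) =
    ((Real.sqrt (u x) : ℝ) : ℂ) • Finsupp.single (Function.update u x (u x - 1)) 1 := by
  rw [ann, Finsupp.lift_apply, Finsupp.sum_single_index]
  · exact one_smul ℂ _
  · exact zero_smul ℂ _

lemma numOp_single' (n : ℕ) (x : BV n) (u : OccT n) :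
    numOp n x (Finsupp.single u 1) = (u x : ℂ) • Finsupp.single u 1 := by
  rw [numOp, Module.End.mul_apply, ann_single', map_smul, cre_single', smul_smul]
  rcases Nat.eq_zero_or_pos (u x) with h | h
  · simp [h]
  · have h1 : u x - 1 + 1 = u x := Nat.sub_add_cancel h
    have h2 : (((u x - 1 : ℕ) : ℝ) + 1) = (u x : ℝ) := by exact_mod_cast h1
    simp only [Function.update_self, Function.update_idem, h1, h2, Function.update_eq_self]
    rw [← Complex.ofReal_mul, Real.mul_self_sqrt (Nat.cast_nonneg _), Complex.ofReal_natCast]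

/-- The unnormalised hopping operator, in diagonal form. -/
noncomputable def diagOp' (n : ℕ) (y : BV n) : FockOp n :=
  ∑ z : BV n, ((chiR z y : ℝ) : ℂ) • numOp n z

lemma diag_single' (n : ℕ) (y : BV n) (u : OccT n) :
    diagOp' n y (Finsupp.single u 1) =
      (∑ z : BV n, ((chiR z y : ℝ) : ℂ) * (u z : ℂ)) • Finsupp.single u 1 := by
  simp only [diagOp', LinearMap.sum_apply, LinearMap.smul_apply, numOp_single', smul_smul,
    Finset.sum_smul]

lemma diag_cre' (n : ℕ) (y w : BV n) (v : FockV n) :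
    diagOp' n y (cre n w v) =
      cre n w (diagOp' n y v) + ((chiR w y : ℝ) : ℂ) • cre n w v := by
  have : diagOp' n y * cre n w = cre n w * diagOp' n y + ((chiR w y : ℝ) : ℂ) • cre n w := by
    apply Finsupp.lhom_ext'
    intro u
    apply LinearMap.ext_ring
    simp only [LinearMap.comp_apply, Finsupp.lsingle_apply, Module.End.mul_apply,
      LinearMap.add_apply, LinearMap.smul_apply, cre_single', diag_single', map_smul, smul_smul,
      ← add_smul]
    congr 1
    have h : ∀ z : BV n, ((chiR z y : ℝ) : ℂ) * ((Function.update u w (u w + 1) z : ℕ) : ℂ)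
        = ((chiR z y : ℝ) : ℂ) * (u z : ℂ) + if z = w then ((chiR w y : ℝ) : ℂ) else 0 := by
      intro z
      by_cases hz : z = w
      · subst hz
        simp
        ring
      · simp [hz]
    simp only [h, Finset.sum_add_distrib, Finset.sum_ite_eq', Finset.mem_univ, if_true]
    ring
  exact LinearMap.congr_fun this v

lemma hop_eq_diag' (n : ℕ) (y : BV n) :
    ∑ x : BV n, mcre n (x + y) * mann n x = diagOp' n y := by
  have h2 : ((Real.sqrt ((2 : ℝ) ^ n))⁻¹ * (Real.sqrt ((2 : ℝ) ^ n))⁻¹) * 2 ^ n = 1 := by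
    rw [← mul_inv, Real.mul_self_sqrt (by positivity)]
    exact inv_mul_cancel₀ (by positivity)
  have h : ∀ x : BV n, mcre n (x + y) * mann n x = ∑ a : BV n, ∑ b : BV n,
      ((((Real.sqrt ((2 : ℝ) ^ n))⁻¹ * (Real.sqrt ((2 : ℝ) ^ n))⁻¹) *
        (chiR a (x + y) * chiR b x) : ℝ) : ℂ) • (cre n a * ann n b) := by
    intro x
    rw [mcre, mann, smul_mul_smul_comm, Finset.sum_mul_sum]
    simp only [Finset.smul_sum, smul_mul_smul_comm, smul_smul]
    push_cast
    rfl
  simp only [h]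
  rw [Finset.sum_comm, diagOp']
  refine Finset.sum_congr rfl fun a _ => ?_
  rw [Finset.sum_comm]
  simp only [← Finset.sum_smul, ← Complex.ofReal_sum, ← Finset.mul_sum, chiR_orth']
  rw [Finset.sum_eq_single a]
  · rw [if_pos rfl, ← mul_assoc, h2, one_mul, numOp]
  · intro b _ hb
    rw [if_neg (Ne.symm hb)]
    simp
  · simp

lemma diag_chain' (n : ℕ) (y : BV n) : ∀ (ℓ : ℕ) (s : Fin ℓ → BV n),
    diagOp' n y (creChain n ℓ s) = ((∑ i, chiR y (s i) : ℝ) : ℂ) • creChain n ℓ s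
  | 0, s => by simp [creChain, vac, diag_single']
  | ℓ + 1, s => by
    have h : creChain n (ℓ + 1) s = cre n (s 0) (creChain n ℓ fun i => s i.succ) := by
      simp [creChain, List.ofFn_succ]
    rw [h, diag_cre', diag_chain' n y ℓ, map_smul, ← add_smul, Fin.sum_univ_succ,
      chiR_comm' (s 0) y]
    congr 1
    push_cast
    ring

/-- single hopping twice applies `γ_y^{(S)}`.
`G̃_y (â_{s_1}† ⋯ â_{s_ℓ}† |vac⟩) = (ℓ^{−1/2} ∑_i (−1)^{y·s_i}) · (â_{s_1}† ⋯ â_{s_ℓ}† |vac⟩)`,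
and consequently `G̃_y²` is diagonal in the position Fock basis with
`G̃_y² (â_{s_1}† ⋯ â_{s_ℓ}† |vac⟩) = γ_y^{(S)} · (â_{s_1}† ⋯ â_{s_ℓ}† |vac⟩)` where
`γ_y^{(S)} = ((1/√ℓ) ∑_i (−1)^{y·s_i})²`. -/
theorem single_hop_eigenvector (n ℓ : ℕ) (y : BV n) (s : Fin ℓ → BV n) :
    sHop n ℓ y (creChain n ℓ s)
        = ((((Real.sqrt (ℓ : ℝ))⁻¹ * ∑ i, chiR y (s i) : ℝ)) : ℂ) • creChain n ℓ s ∧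
    (sHop n ℓ y * sHop n ℓ y) (creChain n ℓ s)
        = ((((Real.sqrt (ℓ : ℝ))⁻¹ * ∑ i, chiR y (s i)) ^ 2 : ℝ) : ℂ) • creChain n ℓ s := by
  have h1 : sHop n ℓ y (creChain n ℓ s)
      = ((((Real.sqrt (ℓ : ℝ))⁻¹ * ∑ i, chiR y (s i) : ℝ)) : ℂ) • creChain n ℓ s := by
    rw [sHop, hop_eq_diag', LinearMap.smul_apply, diag_chain', smul_smul, ← Complex.ofReal_mul]
  refine ⟨h1, ?_⟩
  rw [Module.End.mul_apply, h1, map_smul, h1, smul_smul, ← Complex.ofReal_mul, sq]
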